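/- Let p be an odd prime and f(x) ∈ 𝔽̄_p[x] monic of degree d > 1 with p ∤ d. Then there exist β ∈ 𝔽̄_p and h(x) ∈ 𝔽̄_p[x] such that g(x) := f(x+β) − h(x)^p + h(x) is a monic polynomial of degree d whose coefficient of x^i is zero whenever p divides i, and whose coefficient of x is zero. -/

import Mathlib

open Polynomial

theorem asnf_coeff_pow {K : Type*} [Field K] (p : ℕ) [Fact p.Prime] [CharP K p]
    (h : Polynomial K) (n : ℕ) :
    (h ^ p).coeff n = if p ∣ n then (h.coeff (n / p)) ^ p else 0 := by
  rw [← Polynomial.map_frobenius_expand, Polynomial.coeff_map,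
    Polynomial.coeff_expand (Fact.out : p.Prime).pos]
  split_ifs
  · simp [frobenius_def]
  · simp

theorem asnf_monomial {K : Type*} [Field K] [IsAlgClosed K]
    (p : ℕ) [hp : Fact p.Prime] [CharP K p] (j : ℕ) : ∀ a : K,
    ∃ h : Polynomial K, p * h.natDegree ≤ j ∧
      ∀ i : ℕ, p ∣ i → (C a * X ^ j - h ^ p + h).coeff i = 0 := by
  induction j using Nat.strong_induction_on with
  | _ j ih =>
  intro a
  have hp1 := hp.out.one_lt
  by_cases hj : p ∣ j
  · obtain ⟨k, rfl⟩ := hj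
    rcases Nat.eq_zero_or_pos k with rfl | hk
    · have hd : ((X : K[X]) ^ p - X - C a).degree ≠ 0 := by
        have : (X : K[X]) ^ p - X - C a = X ^ p - (X + C a) := by ring
        rw [this, degree_sub_eq_left_of_degree_lt]
        · rw [degree_X_pow]; exact_mod_cast hp.out.ne_zero
        · rw [degree_X_pow, degree_X_add_C]; exact_mod_cast hp1
      obtain ⟨c, hc⟩ := IsAlgClosed.exists_root _ hd
      refine ⟨C c, by simp, fun i _ => ?_⟩
      have h1 : c ^ p - c - a = 0 := by simpa [IsRoot] using hc
      have : (C a * X ^ (p * 0) - C c ^ p + C c : K[X]) = C (-(c ^ p - c - a)) := by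
        simp only [C_neg, C_sub, C_pow]; ring
      rw [this, h1]; simp
    · obtain ⟨b, hb⟩ := IsAlgClosed.exists_pow_nat_eq a hp.out.pos
      have hlt : k < p * k := by nlinarith
      obtain ⟨h, h1, h2⟩ := ih k hlt b
      refine ⟨C b * X ^ k + h, ?_, fun i hi => ?_⟩
      · refine Nat.mul_le_mul_left p ?_
        refine (natDegree_add_le _ _).trans (max_le (natDegree_C_mul_X_pow_le _ _) ?_)
        nlinarith
      · rw [← h2 i hi, add_pow_char, mul_pow, ← C_pow, hb, ← pow_mul, mul_comm k p]
        congr 1; ring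
  · refine ⟨0, by simp, fun i hi => ?_⟩
    have : i ≠ j := by rintro rfl; exact hj hi
    simp [hp.out.ne_zero, coeff_X_pow, this]

theorem asnf_reduce {K : Type*} [Field K] [IsAlgClosed K]
    (p : ℕ) [hp : Fact p.Prime] [CharP K p] (N : ℕ) (F : K[X]) (hF : F.natDegree ≤ N) :
    ∃ h : Polynomial K, p * h.natDegree ≤ N ∧
      ∀ i : ℕ, p ∣ i → (F - h ^ p + h).coeff i = 0 := by
  refine induction_with_natDegree_le (fun F => ∃ h : Polynomial K, p * h.natDegree ≤ N ∧
      ∀ i : ℕ, p ∣ i → (F - h ^ p + h).coeff i = 0) N ?_ ?_ ?_ F hF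
  · exact ⟨0, by simp, by simp [hp.out.ne_zero]⟩
  · intro n r _ hn
    obtain ⟨h, h1, h2⟩ := asnf_monomial p n r
    exact ⟨h, h1.trans hn, h2⟩
  · rintro F G - - ⟨h, h1, h2⟩ ⟨k, k1, k2⟩
    refine ⟨h + k, ?_, fun i hi => ?_⟩
    · refine (Nat.mul_le_mul_left p (natDegree_add_le _ _)).trans ?_
      rcases max_choice h.natDegree k.natDegree with e | e <;> rw [e] <;> assumption
    · have : F + G - (h + k) ^ p + (h + k) = (F - h ^ p + h) + (G - k ^ p + k) := by
        rw [add_pow_char]; ring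
      rw [this, coeff_add, h2 i hi, k2 i hi, add_zero]

theorem asnf_functional {K : Type*} [Field K]
    (p : ℕ) [hp : Fact p.Prime] [CharP K p] (m : ℕ) (F h : K[X]) (hh : h.natDegree < p ^ m) :
    ∑ k ∈ Finset.range (m + 1), ((F - h ^ p + h).coeff (p ^ k)) ^ p ^ (m - k) =
    ∑ k ∈ Finset.range (m + 1), (F.coeff (p ^ k)) ^ p ^ (m - k) := by
  have e : ∀ k, ((F - h ^ p + h).coeff (p ^ k)) ^ p ^ (m - k) = (F.coeff (p ^ k)) ^ p ^ (m - k)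
      - ((h ^ p).coeff (p ^ k)) ^ p ^ (m - k) + (h.coeff (p ^ k)) ^ p ^ (m - k) := by
    intro k
    rw [coeff_add, coeff_sub, add_pow_char_pow, sub_pow_char_pow]
  simp_rw [e]
  rw [Finset.sum_add_distrib, Finset.sum_sub_distrib]
  have h1 : ∑ k ∈ Finset.range (m + 1), ((h ^ p).coeff (p ^ k)) ^ p ^ (m - k) =
      ∑ k ∈ Finset.range (m + 1), (h.coeff (p ^ k)) ^ p ^ (m - k) := by
    rw [Finset.sum_range_succ', Finset.sum_range_succ]
    congr 1
    · refine Finset.sum_congr rfl fun k hk => ?_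
      have hk := Finset.mem_range.1 hk
      rw [asnf_coeff_pow, if_pos (dvd_pow_self p (by omega)), pow_succ,
        Nat.mul_div_cancel _ hp.out.pos, ← pow_mul, ← pow_succ']
      congr 2; omega
    · rw [asnf_coeff_pow, if_neg (by simpa using hp.out.ne_one), coeff_eq_zero_of_natDegree_lt hh]
      simp [hp.out.ne_zero]
  rw [h1]; ring

theorem asnf_beta {K : Type*} [Field K] [IsAlgClosed K]
    (p : ℕ) [hp : Fact p.Prime] [CharP K p] (m : ℕ) (f : K[X]) (hf : f.Monic)
    (hdeg : 1 < f.natDegree) (hpd : ¬ p ∣ f.natDegree) :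
    ∃ β : K, ∑ k ∈ Finset.range (m + 1), ((taylor β f).coeff (p ^ k)) ^ p ^ (m - k) = 0 := by
  set d := f.natDegree with hd
  set P : K[X] := ∑ k ∈ Finset.range (m + 1), (hasseDeriv (p ^ k) f) ^ p ^ (m - k) with hP
  have hpm : 0 < p ^ m := pow_pos hp.out.pos m
  have hc : P.coeff (p ^ m * (d - 1)) ≠ 0 := by
    rw [hP, Finset.sum_range_succ', coeff_add, finset_sum_coeff, Finset.sum_eq_zero, zero_add]
    · simp only [pow_zero, Nat.sub_zero, hasseDeriv_one]
      have hle : (derivative f).natDegree ≤ d - 1 := natDegree_derivative_le f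
      rw [coeff_pow_of_natDegree_le hle, coeff_derivative]
      apply pow_ne_zero
      have e : d - 1 + 1 = d := by omega
      have e2 : ((d - 1 : ℕ) : K) + 1 = (d : K) := by exact_mod_cast congrArg (Nat.cast (R := K)) e
      rw [e, e2, hd, hf.coeff_natDegree, one_mul]
      rwa [Ne, CharP.cast_eq_zero_iff K p]
    · intro k hk
      apply coeff_eq_zero_of_natDegree_lt
      have h2 : 1 < p ^ (k + 1) := Nat.one_lt_pow (by omega) hp.out.one_lt
      calc _ ≤ p ^ (m - (k + 1)) * (hasseDeriv (p ^ (k + 1)) f).natDegree := natDegree_pow_le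
        _ ≤ p ^ m * (d - p ^ (k + 1)) := Nat.mul_le_mul
            (Nat.pow_le_pow_right hp.out.pos (Nat.sub_le _ _)) (natDegree_hasseDeriv_le _ _)
        _ < _ := Nat.mul_lt_mul_of_pos_left (by omega) hpm
  have hP0 : P.degree ≠ 0 := by
    intro h0
    have := le_natDegree_of_ne_zero hc
    have h00 : P.natDegree = 0 := natDegree_eq_of_degree_eq_some h0
    rw [h00] at this
    have : 0 < p ^ m * (d - 1) := Nat.mul_pos hpm (by omega)
    omega
  obtain ⟨β, hβ⟩ := IsAlgClosed.exists_root P hP0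
  refine ⟨β, ?_⟩
  rw [IsRoot, hP, eval_finset_sum] at hβ
  simpa [taylor_coeff] using hβ

/-- Normal form lemma: for `f` monic of degree `d > 1`, `p ∤ d`, over an algebraically
closed field of odd characteristic `p`, there are `β` and `h` such that
`g = f(x+β) - h^p + h` is monic of degree `d`, with vanishing coefficient at every
`x^i` with `p ∣ i`, and vanishing coefficient of `x`. -/
theorem artinSchreier_normal_form (K : Type*) [Field K] [IsAlgClosed K]
    (p : ℕ) (hp : p.Prime) (hodd : Odd p) [CharP K p]
    (f : Polynomial K) (hf : f.Monic) (hdeg : 1 < f.natDegree)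
    (hpd : ¬ p ∣ f.natDegree) :
    ∃ (β : K) (h : Polynomial K),
      (f.comp (X + C β) - h ^ p + h).Monic ∧
      (f.comp (X + C β) - h ^ p + h).natDegree = f.natDegree ∧
      (∀ i : ℕ, p ∣ i → (f.comp (X + C β) - h ^ p + h).coeff i = 0) ∧
      (f.comp (X + C β) - h ^ p + h).coeff 1 = 0 := by
  haveI : Fact p.Prime := ⟨hp⟩
  set d := f.natDegree with hd
  obtain ⟨β, hβ⟩ := asnf_beta p d f hf hdeg hpd
  have hnat : (taylor β f).natDegree = d := natDegree_taylor f β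
  have hmon : (taylor β f).Monic := by
    rw [Monic, leadingCoeff, hnat, hd, coeff_taylor_natDegree]; exact hf
  obtain ⟨h, h1, h2⟩ := asnf_reduce p d (taylor β f) hnat.le
  have hdp : d < p ^ d := Nat.lt_pow_self hp.one_lt
  have hlt : p * h.natDegree < d := lt_of_le_of_ne h1 fun e => hpd ⟨_, e.symm⟩
  have hlt2 : h.natDegree < d := lt_of_le_of_lt (Nat.le_mul_of_pos_left _ hp.pos) hlt
  have hfun := asnf_functional p d (taylor β f) h (hlt2.trans hdp)
  rw [hβ, Finset.sum_range_succ', Finset.sum_eq_zero, zero_add] at hfun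
  swap
  · intro k _
    rw [h2 _ (dvd_pow_self p (by omega))]
    exact zero_pow (pow_ne_zero _ hp.ne_zero)
  have hq : (-h ^ p + h).natDegree < (taylor β f).natDegree := by
    rw [hnat]
    refine lt_of_le_of_lt (natDegree_add_le _ _) (max_lt ?_ hlt2)
    rw [natDegree_neg]
    exact lt_of_le_of_lt natDegree_pow_le hlt
  have hdq := degree_lt_degree hq
  refine ⟨β, h, ?_⟩
  rw [← taylor_apply]
  have e : taylor β f - h ^ p + h = taylor β f + (-h ^ p + h) := by ring
  refine ⟨?_, ?_, h2, ?_⟩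
  · rw [e]; exact hmon.add_of_left hdq
  · rw [e, natDegree_add_eq_left_of_natDegree_lt hq, hnat]
  · rw [pow_zero] at hfun
    exact eq_zero_of_pow_eq_zero hfun
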